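/- arXiv:quant-ph/0603009 — 3 statements merged into one kernel-verified Lean document; each statement's English description precedes it below -/
import Mathlib

section
/- Let d, n ≥ 2 and let G be a subgroup of GL((ℂ^d)^{⊗n}). Then for every N ≥ n, M_8(H_N) = dim_ℂ(R^N / J^N(G)), where H_N is the subgroup of GL((ℂ^d)^{⊗N}) generated by {g ⊗ I : g ∈ G} (I the identity on (ℂ^d)^{⊗(N−n)}) together with the permutations of the N tensor factors. -/
open Matrix

/-- Index set of the standard basis of `(ℂ^d)^{⊗n}`. -/
abbrev QIdx (d n : ℕ) := Fin n → Fin d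

/-- The unitary operator on `(ℂ^d)^{⊗N}` permuting the tensor factors according to `σ`. -/
def permMatrix (d N : ℕ) (σ : Equiv.Perm (Fin N)) : Matrix (QIdx d N) (QIdx d N) ℂ :=
  Matrix.of fun f g => if f = g ∘ σ then 1 else 0

/-- `u ⊗ I` : the extension of an `n`-qudit gate `u` to `N` qudits, acting as `u` on the
first `n` tensor factors and as the identity on the remaining `N - n` factors. -/
def tensorExt {d n N : ℕ} (h : n ≤ N) (u : Matrix (QIdx d n) (QIdx d n) ℂ) :
    Matrix (QIdx d N) (QIdx d N) ℂ :=
  Matrix.of fun f g =>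
    u (fun i => f (Fin.castLE h i)) (fun i => g (Fin.castLE h i)) *
      (if ∀ j : Fin N, n ≤ (j : ℕ) → f j = g j then 1 else 0)


/-- The `k`-th tensor power of a matrix (acting on `V^{⊗k}` where `V = ℂ^ι`). -/
def tpow {ι : Type*} [Fintype ι] (k : ℕ) (g : Matrix ι ι ℂ) :
    Matrix (Fin k → ι) (Fin k → ι) ℂ :=
  Matrix.of fun f f' => ∏ i, g (f i) (f' i)

/-- The space of linear functionals on `End(V^{⊗k})` invariant under the conjugation
action `X ↦ g^{⊗k} X (g^{⊗k})⁻¹` of all `g ∈ C`. -/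
noncomputable def invFunctionals {ι : Type*} [Fintype ι] [DecidableEq ι] (k : ℕ)
    (C : Set (Matrix ι ι ℂ)) :
    Submodule ℂ ((Matrix (Fin k → ι) (Fin k → ι) ℂ) →ₗ[ℂ] ℂ) where
  carrier := {f | ∀ g ∈ C, ∀ X, f (tpow k g * X * tpow k g⁻¹) = f X}
  add_mem' := by intro a b ha hb g hg X; simp [ha g hg X, hb g hg X]
  zero_mem' := by intro g hg X; simp
  smul_mem' := by intro c a ha g hg X; simp [ha g hg X]

/-- `M_{2k}(C)`: the dimension of the space of invariant linear functionals on
`End(V^{⊗k})` for the conjugation action of `C`. -/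
noncomputable def Mdim {ι : Type*} [Fintype ι] [DecidableEq ι] (k : ℕ)
    (C : Set (Matrix ι ι ℂ)) : ℕ :=
  Module.finrank ℂ (invFunctionals k C)

/-- The canonical projection of `W^{⊗N}` (for `W = ℂ^ι`, in its standard basis indexed by
`ι`) onto the `N`-th symmetric power of `W`, realized as the space of homogeneous
polynomials of degree `N` inside the polynomial ring `ℂ[x_i : i ∈ ι]`: the basis tensor
`w_{f 0} ⊗ ⋯ ⊗ w_{f (N-1)}` is sent to the monomial `x_{f 0} ⋯ x_{f (N-1)}`. -/
noncomputable def phi (ι : Type*) [Fintype ι] (N : ℕ) :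
    ((Fin N → ι) → ℂ) →ₗ[ℂ] MvPolynomial ι ℂ where
  toFun v := ∑ f : Fin N → ι, v f • ∏ i, MvPolynomial.X (f i)
  map_add' x y := by simp [add_smul, Finset.sum_add_distrib]
  map_smul' c x := by simp [smul_smul, Finset.smul_sum]

/-- Index of the standard basis of `W = (ℂ^d)^{⊗4} ⊗ ((ℂ^d)^*)^{⊗4}`. -/
abbrev Wix (d : ℕ) := (Fin 4 → Fin d) × (Fin 4 → Fin d)

/-- The action of `g ∈ GL((ℂ^d)^{⊗n})` (with inverse `ginv`) on
`W^{⊗n} ≅ V^{⊗4} ⊗ (V^*)^{⊗4}` (where `V = (ℂ^d)^{⊗n}`): `g` acts naturally on the four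
`V`-factors and contragradiently on the four dual factors. -/
def wAction {d n : ℕ} (g ginv : Matrix (Fin n → Fin d) (Fin n → Fin d) ℂ) :
    Matrix (Fin n → Wix d) (Fin n → Wix d) ℂ :=
  Matrix.of fun f f' =>
    (∏ a : Fin 4, g (fun i => (f i).1 a) (fun i => (f' i).1 a)) *
    (∏ a : Fin 4, ginv (fun i => (f' i).2 a) (fun i => (f i).2 a))

/-- The annihilator `A ⊆ W^{⊗n}` of the space of `G`-invariant linear functionals on
`W^{⊗n}`. -/
def wAnn (d n : ℕ) (G : Subgroup (Matrix (Fin n → Fin d) (Fin n → Fin d) ℂ)ˣ) :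
    Set ((Fin n → Wix d) → ℂ) :=
  {v | ∀ f : ((Fin n → Wix d) → ℂ) →ₗ[ℂ] ℂ,
    (∀ g ∈ G, ∀ w, f (wAction (↑g : Matrix _ _ ℂ) (↑g⁻¹ : Matrix _ _ ℂ) *ᵥ w) = f w) →
      f v = 0}

/-- The ideal `J(G)` of `R = ℂ[x_w : w ∈ Wix d]` generated by `φ(A)`, where `A` is the
annihilator of the `G`-invariant functionals on `W^{⊗n}` and `φ` sends basis tensors to
monomials. -/
noncomputable def Jideal (d n : ℕ)
    (G : Subgroup (Matrix (Fin n → Fin d) (Fin n → Fin d) ℂ)ˣ) :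
    Ideal (MvPolynomial (Wix d) ℂ) :=
  Ideal.span ((phi (Wix d) n) '' (wAnn d n G))

/-- `dim_ℂ (R^N / J^N)`: the value at `N` of the Hilbert function of a homogeneous ideal
`J`, i.e. the codimension in the space `R^N` of homogeneous polynomials of degree `N` of
its subspace `J^N = J ∩ R^N`. -/
noncomputable def hilb {ι : Type*} [Fintype ι] [DecidableEq ι]
    (J : Ideal (MvPolynomial ι ℂ)) (N : ℕ) : ℕ :=
  Module.finrank ℂ
    ((MvPolynomial.homogeneousSubmodule ι ℂ N) ⧸
      (Submodule.comap (MvPolynomial.homogeneousSubmodule ι ℂ N).subtype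
        (Submodule.restrictScalars ℂ J)))

/-- The subgroup `H_N` of `GL((ℂ^d)^{⊗N})` generated by the operators `g ⊗ I` for `g ∈ G`
together with the permutations of the `N` tensor factors (as a set of matrices; since the
generating set is closed under inverses, the submonoid it generates is the subgroup it
generates). -/
def HN (d n N : ℕ) (h : n ≤ N)
    (G : Subgroup (Matrix (Fin n → Fin d) (Fin n → Fin d) ℂ)ˣ) :
    Set (Matrix (QIdx d N) (QIdx d N) ℂ) :=
  ↑(Submonoid.closure
      ({A | ∃ g ∈ G, A = tensorExt h (↑g : Matrix _ _ ℂ)} ∪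
        {A | ∃ σ : Equiv.Perm (Fin N), A = permMatrix d N σ}))

section Monomials

variable {ι : Type*}

theorem prod_X_eq_monomial {N : ℕ} (w : Fin N → ι) :
    ∏ i, (MvPolynomial.X (w i) : MvPolynomial ι ℂ) =
      MvPolynomial.monomial (∑ i, Finsupp.single (w i) 1) 1 := by
  rw [MvPolynomial.monomial_sum_one]
  rfl

theorem degree_sum_single {N : ℕ} (w : Fin N → ι) :
    (∑ i, Finsupp.single (w i) (1 : ℕ)).degree = N := by
  simp [map_sum]

theorem exists_sum_single_eq {N : ℕ} (m : ι →₀ ℕ) (hm : m.degree = N) :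
    ∃ w : Fin N → ι, ∑ i, Finsupp.single (w i) 1 = m := by
  subst hm
  induction m using Finsupp.induction_linear with
  | zero =>
    rw [map_zero]
    exact ⟨Fin.elim0, by simp⟩
  | add a b ha hb =>
    obtain ⟨u, hu⟩ := ha
    obtain ⟨v, hv⟩ := hb
    rw [map_add]
    exact ⟨Fin.append u v, by simp [Fin.sum_univ_add, hu, hv]⟩
  | single a k =>
    rw [Finsupp.degree_single]
    exact ⟨fun _ => a, by simp⟩

theorem exists_perm_of_sum_single_eq {N : ℕ} {w w' : Fin N → ι}
    (hw : ∑ i, Finsupp.single (w i) (1 : ℕ) = ∑ i, Finsupp.single (w' i) 1) :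
    ∃ σ : Equiv.Perm (Fin N), w = w' ∘ σ := by
  classical
  have key : ∀ c, Fintype.card {i // w i = c} = Fintype.card {i // w' i = c} := by
    intro c
    have := DFunLike.congr_fun hw c
    simpa [Finsupp.finsetSum_apply, Finsupp.single_apply, Fintype.card_subtype] using this
  refine ⟨Equiv.ofFiberEquiv fun c => Fintype.equivOfCardEq (key c), ?_⟩
  funext i
  exact (Equiv.ofFiberEquiv_map _ i).symm

/-- A permutation-invariant function on basis tensors of `W^{⊗N}` descends to a linear functional
on polynomials which vanishes on monomials of degree different from `N`. -/
theorem exists_functional_of_perm_invariant {N : ℕ} (F : (Fin N → ι) → ℂ)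
    (hF : ∀ (σ : Equiv.Perm (Fin N)) w, F (w ∘ σ) = F w) :
    ∃ L : MvPolynomial ι ℂ →ₗ[ℂ] ℂ,
      (∀ w : Fin N → ι, L (MvPolynomial.monomial (∑ i, Finsupp.single (w i) 1) 1) = F w) ∧
      ∀ m : ι →₀ ℕ, m.degree ≠ N → L (MvPolynomial.monomial m 1) = 0 := by
  classical
  let L : MvPolynomial ι ℂ →ₗ[ℂ] ℂ := (MvPolynomial.basisMonomials ι ℂ).constr ℂ fun m =>
    if hm : ∃ w : Fin N → ι, ∑ i, Finsupp.single (w i) 1 = m then F hm.choose else 0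
  have hL (m) : L (MvPolynomial.monomial m 1) =
      if hm : ∃ w : Fin N → ι, ∑ i, Finsupp.single (w i) 1 = m then F hm.choose else 0 := by
    exact Module.Basis.constr_basis (MvPolynomial.basisMonomials ι ℂ) ℂ _ m
  refine ⟨L, fun w => ?_, fun m hm => ?_⟩
  · have hex : ∃ w' : Fin N → ι,
        ∑ i, Finsupp.single (w' i) (1 : ℕ) = ∑ i, Finsupp.single (w i) 1 := ⟨w, rfl⟩
    rw [hL, dif_pos hex]
    obtain ⟨σ, hσ⟩ := exists_perm_of_sum_single_eq hex.choose_spec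
    rw [hσ, hF]
  · rw [hL, dif_neg]
    rintro ⟨w, rfl⟩
    exact hm (degree_sum_single w)

/-- The tensor `v ⊗ w_{s 0} ⊗ ⋯ ⊗ w_{s (m-1)}`. -/
def tensorBasis [DecidableEq ι] {n m : ℕ} (s : Fin m → ι) (v : (Fin n → ι) → ℂ) :
    (Fin (n + m) → ι) → ℂ :=
  fun x => if (fun j => x (Fin.natAdd n j)) = s then v (fun i => x (Fin.castAdd m i)) else 0

theorem tensorBasis_append [DecidableEq ι] {n m : ℕ} (s t : Fin m → ι) (v : (Fin n → ι) → ℂ)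
    (f : Fin n → ι) :
    tensorBasis s v (Fin.append f t) = if t = s then v f else 0 := by
  simp [tensorBasis]

theorem tensorBasis_sub [DecidableEq ι] {n m : ℕ} (s : Fin m → ι) (v w : (Fin n → ι) → ℂ) :
    tensorBasis s (v - w) = tensorBasis s v - tensorBasis s w := by
  funext x
  simp only [tensorBasis, Pi.sub_apply]
  split_ifs <;> simp

theorem tensorBasis_add [DecidableEq ι] {n m : ℕ} (s : Fin m → ι) (v w : (Fin n → ι) → ℂ) :
    tensorBasis s (v + w) = tensorBasis s v + tensorBasis s w := by
  funext x
  simp only [tensorBasis, Pi.add_apply]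
  split_ifs <;> simp

theorem tensorBasis_smul [DecidableEq ι] {n m : ℕ} (s : Fin m → ι) (c : ℂ)
    (v : (Fin n → ι) → ℂ) :
    tensorBasis s (c • v) = c • tensorBasis s v := by
  funext x
  simp only [tensorBasis, Pi.smul_apply]
  split_ifs <;> simp

variable [Fintype ι]

theorem phi_apply (N : ℕ) (v : (Fin N → ι) → ℂ) :
    phi ι N v = ∑ f : Fin N → ι, v f • ∏ i, MvPolynomial.X (f i) := rfl

theorem phi_mem_homogeneousSubmodule (N : ℕ) (v : (Fin N → ι) → ℂ) :
    phi ι N v ∈ MvPolynomial.homogeneousSubmodule ι ℂ N := by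
  refine Submodule.sum_mem _ fun f _ => Submodule.smul_mem _ _ ?_
  rw [prod_X_eq_monomial]
  exact MvPolynomial.isHomogeneous_monomial _ (degree_sum_single f)

theorem exists_phi_eq {N : ℕ} {p : MvPolynomial ι ℂ} (hp : p.IsHomogeneous N) :
    ∃ v, phi ι N v = p := by
  classical
  change p ∈ LinearMap.range (phi ι N)
  rw [← MvPolynomial.support_sum_monomial_coeff p]
  refine Submodule.sum_mem _ fun m hm => ?_
  obtain ⟨w, hw⟩ := exists_sum_single_eq (N := N) m
    (by rw [Finsupp.degree_eq_weight_one]; exact hp (MvPolynomial.mem_support_iff.mp hm))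
  refine ⟨Pi.single w (p.coeff m), ?_⟩
  rw [phi_apply, Finset.sum_eq_single w]
  · simp [prod_X_eq_monomial, hw, MvPolynomial.smul_monomial]
  · intro f _ hf
    simp [hf]
  · simp

theorem sum_append {M : Type*} [AddCommMonoid M] {n m : ℕ} (F : (Fin (n + m) → ι) → M) :
    ∑ x, F x = ∑ f : Fin n → ι, ∑ s : Fin m → ι, F (Fin.append f s) := by
  rw [← (Fin.appendEquiv n m).sum_comp, Fintype.sum_prod_type]
  rfl

theorem sum_tensorBasis [DecidableEq ι] {n m : ℕ} (v : (Fin (n + m) → ι) → ℂ) :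
    ∑ s : Fin m → ι, tensorBasis s (fun f => v (Fin.append f s)) = v := by
  funext x
  obtain ⟨⟨f, t⟩, rfl⟩ := (Fin.appendEquiv n m).surjective x
  change _ = v (Fin.append f t)
  change (∑ s : Fin m → ι, tensorBasis s (fun f => v (Fin.append f s))) (Fin.append f t) = _
  simp [Finset.sum_apply, tensorBasis_append]

theorem phi_tensorBasis [DecidableEq ι] {n m : ℕ} (s : Fin m → ι) (v : (Fin n → ι) → ℂ) :
    phi ι (n + m) (tensorBasis s v) = phi ι n v * ∏ j, MvPolynomial.X (s j) := by
  rw [phi_apply, sum_append, phi_apply, Finset.sum_mul]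
  refine Finset.sum_congr rfl fun f _ => ?_
  rw [Finset.sum_eq_single s]
  · simp [tensorBasis_append, Fin.prod_univ_add]
  · intro t _ ht
    simp [tensorBasis_append, ht]
  · simp

end Monomials

section Gates

theorem permMatrix_mul (d N : ℕ) (σ τ : Equiv.Perm (Fin N)) :
    permMatrix d N σ * permMatrix d N τ = permMatrix d N (τ * σ) := by
  ext f k
  rw [Matrix.mul_apply, Finset.sum_eq_single (k ∘ τ)]
  · simp [permMatrix, Function.comp_assoc]
    rfl
  · intro g _ hg
    simp [permMatrix, hg]
  · simp

theorem permMatrix_one (d N : ℕ) : permMatrix d N 1 = 1 := by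
  ext f k
  simp [permMatrix, Matrix.one_apply]

theorem inv_permMatrix (d N : ℕ) (σ : Equiv.Perm (Fin N)) :
    (permMatrix d N σ)⁻¹ = permMatrix d N σ⁻¹ :=
  Matrix.inv_eq_right_inv (by rw [permMatrix_mul, inv_mul_cancel, permMatrix_one])

theorem tensorExt_append {d n m : ℕ} (h : n ≤ n + m) (u : Matrix (QIdx d n) (QIdx d n) ℂ)
    (f g : QIdx d n) (s t : QIdx d m) :
    tensorExt h u (Fin.append f s) (Fin.append g t) = u f g * if s = t then 1 else 0 := by
  have hst : (∀ j : Fin (n + m), n ≤ (j : ℕ) →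
      (Fin.append f s : QIdx d (n + m)) j = (Fin.append g t : QIdx d (n + m)) j) ↔ s = t := by
    constructor
    · intro H
      funext j
      simpa using H (Fin.natAdd n j) (by simp)
    · rintro rfl j
      refine Fin.addCases (fun i hi => ?_) (fun i _ => ?_) j
      · simp at hi; omega
      · simp
  have hl (f : QIdx d n) (s : QIdx d m) :
      (fun i => (Fin.append f s : QIdx d (n + m)) (Fin.castLE h i)) = f :=
    funext fun i => Fin.append_left f s i
  simp only [tensorExt, Matrix.of_apply, hst, hl]

theorem tensorExt_mul {d n m : ℕ} (h : n ≤ n + m) (u v : Matrix (QIdx d n) (QIdx d n) ℂ) :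
    tensorExt h u * tensorExt h v = tensorExt h (u * v) := by
  ext x y
  obtain ⟨⟨f, s⟩, rfl⟩ := (Fin.appendEquiv n m).surjective x
  obtain ⟨⟨g, t⟩, rfl⟩ := (Fin.appendEquiv n m).surjective y
  change (tensorExt h u * tensorExt h v) (Fin.append f s) (Fin.append g t) =
    tensorExt h (u * v) (Fin.append f s) (Fin.append g t)
  rw [Matrix.mul_apply, sum_append]
  simp [tensorExt_append, Matrix.mul_apply]

theorem tensorExt_one {d n m : ℕ} (h : n ≤ n + m) :
    tensorExt h (1 : Matrix (QIdx d n) (QIdx d n) ℂ) = 1 := by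
  ext x y
  obtain ⟨⟨f, s⟩, rfl⟩ := (Fin.appendEquiv n m).surjective x
  obtain ⟨⟨g, t⟩, rfl⟩ := (Fin.appendEquiv n m).surjective y
  have hinj : (Fin.append f s : QIdx d (n + m)) = Fin.append g t ↔ f = g ∧ s = t := by
    rw [← Prod.mk.injEq, ← (Fin.appendEquiv n m).injective.eq_iff]
    rfl
  change tensorExt h 1 (Fin.append f s) (Fin.append g t) =
    (1 : Matrix (QIdx d (n + m)) (QIdx d (n + m)) ℂ) (Fin.append f s) (Fin.append g t)
  rw [tensorExt_append, Matrix.one_apply, Matrix.one_apply]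
  simp only [hinj, ite_and]
  split_ifs <;> simp

theorem inv_tensorExt {d n m : ℕ} (h : n ≤ n + m) (g : (Matrix (QIdx d n) (QIdx d n) ℂ)ˣ) :
    (tensorExt h (g : Matrix (QIdx d n) (QIdx d n) ℂ))⁻¹ = tensorExt h (↑g⁻¹ : Matrix _ _ ℂ) :=
  Matrix.inv_eq_right_inv (by rw [tensorExt_mul, Units.mul_inv, tensorExt_one])

theorem wAction_permMatrix_mulVec {d N : ℕ} (σ : Equiv.Perm (Fin N))
    (v : (Fin N → Wix d) → ℂ) (f : Fin N → Wix d) :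
    (wAction (permMatrix d N σ) (permMatrix d N σ⁻¹) *ᵥ v) f = v (f ∘ ⇑σ⁻¹) := by
  have hiff (f' : Fin N → Wix d) :
      ((∀ a, (fun i => (f i).1 a) = (fun i => (f' i).1 a) ∘ σ) ∧
        ∀ a, (fun i => (f' i).2 a) = (fun i => (f i).2 a) ∘ ⇑σ⁻¹) ↔ f' = f ∘ ⇑σ⁻¹ := by
    constructor
    · rintro ⟨h1, h2⟩
      funext i
      refine Prod.ext (funext fun a => ?_) (funext fun a => congrFun (h2 a) i)
      simpa using (congrFun (h1 a) (σ⁻¹ i)).symm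
    · rintro rfl
      refine ⟨fun a => funext fun i => ?_, fun a => rfl⟩
      simp
  have hentry (f' : Fin N → Wix d) :
      wAction (permMatrix d N σ) (permMatrix d N σ⁻¹) f f' = if f' = f ∘ ⇑σ⁻¹ then 1 else 0 := by
    simp only [wAction, permMatrix, Matrix.of_apply, Finset.prod_boole, Finset.mem_univ,
      true_imp_iff, ← hiff f', ite_and]
    split_ifs <;> simp_all
  simp [Matrix.mulVec, dotProduct, hentry]

theorem wAction_tensorExt_append {d n m : ℕ} (h : n ≤ n + m)
    (u v : Matrix (QIdx d n) (QIdx d n) ℂ) (f g : Fin n → Wix d) (s t : Fin m → Wix d) :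
    wAction (tensorExt h u) (tensorExt h v) (Fin.append f s) (Fin.append g t) =
      wAction u v f g * if s = t then 1 else 0 := by
  have happ (k : Wix d → Fin d) (f : Fin n → Wix d) (s : Fin m → Wix d) :
      (fun i => k ((Fin.append f s : Fin (n + m) → Wix d) i)) =
        Fin.append (fun i => k (f i)) (fun j => k (s j)) := by
    funext i
    refine Fin.addCases (fun i => ?_) (fun i => ?_) i <;> simp
  have h1 (a : Fin 4) := happ fun x => x.1 a
  have h2 (a : Fin 4) := happ fun x => x.2 a
  have hiff : s = t ↔ (∀ a, (fun j => (s j).1 a) = fun j => (t j).1 a) ∧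
      ∀ a, (fun j => (t j).2 a) = fun j => (s j).2 a := by
    constructor
    · rintro rfl
      exact ⟨fun _ => rfl, fun _ => rfl⟩
    · rintro ⟨H1, H2⟩
      funext j
      exact Prod.ext (funext fun a => congrFun (H1 a) j) (funext fun a => (congrFun (H2 a) j).symm)
  simp only [wAction, Matrix.of_apply, h1, h2, tensorExt_append, Finset.prod_mul_distrib,
    Finset.prod_boole, Finset.mem_univ, true_imp_iff, hiff, ite_and]
  split_ifs <;> simp

theorem wAction_tensorExt_mulVec {d n m : ℕ} (h : n ≤ n + m)
    (u v : Matrix (QIdx d n) (QIdx d n) ℂ) (s : Fin m → Wix d) (w : (Fin n → Wix d) → ℂ) :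
    wAction (tensorExt h u) (tensorExt h v) *ᵥ tensorBasis s w =
      tensorBasis s (wAction u v *ᵥ w) := by
  funext x
  obtain ⟨⟨f, t⟩, rfl⟩ := (Fin.appendEquiv n m).surjective x
  change (wAction (tensorExt h u) (tensorExt h v) *ᵥ tensorBasis s w) (Fin.append f t) =
    tensorBasis s (wAction u v *ᵥ w) (Fin.append f t)
  simp only [Matrix.mulVec, dotProduct]
  rw [sum_append]
  by_cases hts : t = s <;>
    simp [tensorBasis_append, wAction_tensorExt_append, hts, Matrix.mulVec, dotProduct]

theorem tpow_mul {ι : Type*} [Fintype ι] [DecidableEq ι] (k : ℕ) (g h : Matrix ι ι ℂ) :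
    tpow k (g * h) = tpow k g * tpow k h := by
  ext f f'
  simp only [tpow, Matrix.of_apply, Matrix.mul_apply, ← Finset.prod_mul_distrib]
  exact Fintype.prod_sum fun i j => g (f i) j * h j (f' i)

theorem tpow_one {ι : Type*} [Fintype ι] [DecidableEq ι] (k : ℕ) :
    tpow k (1 : Matrix ι ι ℂ) = 1 := by
  ext f f'
  simp [tpow, Matrix.one_apply, Finset.prod_boole, funext_iff]

end Gates

section Invariants

/-- The identification of pairs of basis indices of `V^{⊗4}`, `V = (ℂ^d)^{⊗N}`, with
basis indices of `W^{⊗N}`. -/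
def wixEquiv (d N : ℕ) :
    (Fin 4 → QIdx d N) × (Fin 4 → QIdx d N) ≃ (Fin N → Wix d) where
  toFun x i := (fun a => x.1 a i, fun a => x.2 a i)
  invFun w := (fun a i => (w i).1 a, fun a i => (w i).2 a)
  left_inv _ := rfl
  right_inv _ := rfl

/-- The identification `End(V^{⊗4}) ≅ W^{⊗N}` for `V = (ℂ^d)^{⊗N}`. -/
def endEquiv (d N : ℕ) :
    Matrix (Fin 4 → QIdx d N) (Fin 4 → QIdx d N) ℂ ≃ₗ[ℂ] ((Fin N → Wix d) → ℂ) where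
  toFun X w := X ((wixEquiv d N).symm w).1 ((wixEquiv d N).symm w).2
  invFun v := Matrix.of fun x y => v (wixEquiv d N (x, y))
  map_add' _ _ := rfl
  map_smul' _ _ := rfl
  left_inv _ := rfl
  right_inv _ := rfl

theorem endEquiv_conj {d N : ℕ} (g k : Matrix (QIdx d N) (QIdx d N) ℂ)
    (X : Matrix (Fin 4 → QIdx d N) (Fin 4 → QIdx d N) ℂ) :
    endEquiv d N (tpow 4 g * X * tpow 4 k) = wAction g k *ᵥ endEquiv d N X := by
  funext w
  rw [Matrix.mulVec, dotProduct, ← (wixEquiv d N).sum_comp, Fintype.sum_prod_type_right]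
  change (tpow 4 g * X * tpow 4 k) _ _ = _
  rw [Matrix.mul_apply]
  refine Finset.sum_congr rfl fun y _ => ?_
  rw [Matrix.mul_apply, Finset.sum_mul]
  refine Finset.sum_congr rfl fun x _ => ?_
  rw [mul_assoc, mul_comm (X x y), ← mul_assoc]
  rfl

theorem mem_invFunctionals_HN_iff {d n N : ℕ} (h : n ≤ N)
    (G : Subgroup (Matrix (Fin n → Fin d) (Fin n → Fin d) ℂ)ˣ)
    (f : Matrix (Fin 4 → QIdx d N) (Fin 4 → QIdx d N) ℂ →ₗ[ℂ] ℂ) :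
    f ∈ invFunctionals 4 (HN d n N h G) ↔
      (∀ g ∈ G, ∀ X, f (tpow 4 (tensorExt h (g : Matrix _ _ ℂ)) * X *
        tpow 4 (tensorExt h (g : Matrix _ _ ℂ))⁻¹) = f X) ∧
      ∀ σ : Equiv.Perm (Fin N), ∀ X, f (tpow 4 (permMatrix d N σ) * X *
        tpow 4 (permMatrix d N σ)⁻¹) = f X := by
  constructor
  · intro hf
    exact ⟨fun g hg => hf _ (Submonoid.subset_closure (Or.inl ⟨g, hg, rfl⟩)),
      fun σ => hf _ (Submonoid.subset_closure (Or.inr ⟨σ, rfl⟩))⟩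
  · rintro ⟨hG, hP⟩ A hA
    induction hA using Submonoid.closure_induction with
    | mem A hA =>
      rcases hA with ⟨g, hg, rfl⟩ | ⟨σ, rfl⟩
      · exact hG g hg
      · exact hP σ
    | one => simp [tpow_one]
    | mul A B _ _ hA hB =>
      intro X
      rw [Matrix.mul_inv_rev, tpow_mul, tpow_mul, ← hB X,
        ← hA (tpow 4 B * X * tpow 4 B⁻¹)]
      simp only [Matrix.mul_assoc]

theorem phi_wAction_permMatrix {d N : ℕ} (σ : Equiv.Perm (Fin N)) (v : (Fin N → Wix d) → ℂ) :
    phi (Wix d) N (wAction (permMatrix d N σ) (permMatrix d N σ⁻¹) *ᵥ v) =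
      phi (Wix d) N v := by
  rw [phi_apply, phi_apply]
  refine Fintype.sum_equiv (Equiv.arrowCongr σ (Equiv.refl (Wix d))) _ _ fun f => ?_
  rw [wAction_permMatrix_mulVec]
  congr 1
  exact (Equiv.prod_comp σ⁻¹ fun i => (MvPolynomial.X (f i) : MvPolynomial (Wix d) ℂ)).symm

theorem wAction_sub_mem_wAnn {d n : ℕ}
    {G : Subgroup (Matrix (Fin n → Fin d) (Fin n → Fin d) ℂ)ˣ}
    {g : (Matrix (Fin n → Fin d) (Fin n → Fin d) ℂ)ˣ} (hg : g ∈ G) (w : (Fin n → Wix d) → ℂ) :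
    wAction (↑g : Matrix _ _ ℂ) (↑g⁻¹ : Matrix _ _ ℂ) *ᵥ w - w ∈ wAnn d n G := by
  intro f hf
  rw [map_sub, hf g hg, sub_self]

theorem phi_wAction_tensorExt_sub_mem {d n m : ℕ} (h : n ≤ n + m)
    {G : Subgroup (Matrix (Fin n → Fin d) (Fin n → Fin d) ℂ)ˣ}
    {g : (Matrix (Fin n → Fin d) (Fin n → Fin d) ℂ)ˣ} (hg : g ∈ G)
    (v : (Fin (n + m) → Wix d) → ℂ) :
    phi (Wix d) (n + m) (wAction (tensorExt h (g : Matrix _ _ ℂ))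
      (tensorExt h (↑g⁻¹ : Matrix _ _ ℂ)) *ᵥ v - v) ∈ Jideal d n G := by
  rw [← sum_tensorBasis v, Matrix.mulVec_sum, ← Finset.sum_sub_distrib, map_sum]
  refine Ideal.sum_mem _ fun s _ => ?_
  rw [wAction_tensorExt_mulVec, ← tensorBasis_sub, phi_tensorBasis]
  exact Ideal.mul_mem_right _ _
    (Ideal.subset_span (Set.mem_image_of_mem _ (wAction_sub_mem_wAnn hg _)))

/-- A functional on `W^{⊗(n+m)}` invariant under permutations of the factors and under
`G` acting on the first `n` factors kills every tensor whose image under `phi` lies in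
`Jideal d n G`. -/
theorem eq_zero_of_phi_mem_Jideal {d n m : ℕ} (h : n ≤ n + m)
    {G : Subgroup (Matrix (Fin n → Fin d) (Fin n → Fin d) ℂ)ˣ}
    (f : ((Fin (n + m) → Wix d) → ℂ) →ₗ[ℂ] ℂ)
    (hG : ∀ g ∈ G, ∀ v, f (wAction (tensorExt h (g : Matrix _ _ ℂ))
      (tensorExt h (↑g⁻¹ : Matrix _ _ ℂ)) *ᵥ v) = f v)
    (hP : ∀ (σ : Equiv.Perm (Fin (n + m))) v, f (wAction (permMatrix d (n + m) σ)
      (permMatrix d (n + m) σ⁻¹) *ᵥ v) = f v)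
    {v : (Fin (n + m) → Wix d) → ℂ} (hv : phi (Wix d) (n + m) v ∈ Jideal d n G) :
    f v = 0 := by
  obtain ⟨L, hL, hL0⟩ := exists_functional_of_perm_invariant
    (fun w : Fin (n + m) → Wix d => f (Pi.single w 1)) (fun σ w => by
      rw [← hP σ (Pi.single w 1)]
      congr 1
      funext x
      rw [wAction_permMatrix_mulVec]
      simp only [Pi.single_apply]
      refine if_congr ?_ rfl rfl
      constructor
      · rintro rfl
        funext i
        simp
      · rintro rfl
        funext i
        simp)
  have hLphi (v) : L (phi (Wix d) (n + m) v) = f v := by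
    conv_rhs => rw [pi_eq_sum_univ' v]
    simp only [phi_apply, map_sum, map_smul, prod_X_eq_monomial, hL]
  rw [← hLphi]
  have hgen (v) (hv : v ∈ wAnn d n G) (q : MvPolynomial (Wix d) ℂ) :
      L (q * phi (Wix d) n v) = 0 := by
    induction q using MvPolynomial.induction_on' with
    | add p q hp hq => rw [add_mul, map_add, hp, hq, add_zero]
    | monomial e c =>
      rw [← mul_one c, ← smul_eq_mul c, ← MvPolynomial.smul_monomial, smul_mul_assoc, map_smul]
      refine smul_eq_zero_of_right c ?_
      by_cases he : e.degree = m
      · obtain ⟨s, rfl⟩ := exists_sum_single_eq e he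
        rw [← prod_X_eq_monomial, mul_comm, ← phi_tensorBasis, hLphi]
        let T : ((Fin n → Wix d) → ℂ) →ₗ[ℂ] ((Fin (n + m) → Wix d) → ℂ) :=
          { toFun := tensorBasis s
            map_add' := tensorBasis_add s
            map_smul' := tensorBasis_smul s }
        refine hv (f ∘ₗ T) fun g hg w => ?_
        change f (tensorBasis s _) = f (tensorBasis s w)
        rw [← wAction_tensorExt_mulVec h, hG g hg]
      · rw [phi_apply, Finset.mul_sum, map_sum]
        refine Finset.sum_eq_zero fun w _ => ?_
        rw [mul_smul_comm, map_smul, prod_X_eq_monomial, MvPolynomial.monomial_mul, one_mul,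
          hL0, smul_zero]
        rw [map_add, degree_sum_single]
        omega
  have hmem (p) (hp : p ∈ Jideal d n G) : ∀ q, L (q * p) = 0 := by
    induction hp using Submodule.span_induction with
    | mem p hp =>
      obtain ⟨v, hv, rfl⟩ := hp
      exact hgen v hv
    | zero => simp
    | add p p' _ _ hp hp' => intro q; rw [mul_add, map_add, hp, hp', add_zero]
    | smul a p _ hp => intro q; rw [smul_eq_mul, ← mul_assoc, hp]
  simpa using hmem _ hv 1

end Invariants

/-- For `d, n ≥ 2`, a subgroup `G ≤ GL((ℂ^d)^{⊗n})` and `N ≥ n`,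
`M_8(H_N) = dim_ℂ (R^N / J^N(G))`, where `H_N` is the subgroup of `GL((ℂ^d)^{⊗N})`
generated by `{g ⊗ I : g ∈ G}` and the permutations of the `N` tensor factors. -/
theorem M8_eq_hilbert_function {d n : ℕ} (hd : 2 ≤ d) (hn : 2 ≤ n)
    (G : Subgroup (Matrix (Fin n → Fin d) (Fin n → Fin d) ℂ)ˣ)
    (N : ℕ) (h : n ≤ N) :
    Mdim 4 (HN d n N h G) = hilb (Jideal d n G) N := by
  obtain ⟨m, rfl⟩ := Nat.exists_eq_add_of_le h
  let K := Submodule.comap (MvPolynomial.homogeneousSubmodule (Wix d) ℂ (n + m)).subtype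
    (Submodule.restrictScalars ℂ (Jideal d n G))
  let φ := (phi (Wix d) (n + m)).codRestrict
    (MvPolynomial.homogeneousSubmodule (Wix d) ℂ (n + m)) (phi_mem_homogeneousSubmodule _)
  let P := K.mkQ ∘ₗ φ ∘ₗ (endEquiv d (n + m)).toLinearMap
  have hφ : Function.Surjective φ := fun ⟨p, hp⟩ =>
    (exists_phi_eq hp).imp fun v hv => Subtype.ext hv
  have hP : Function.Surjective P :=
    K.mkQ_surjective.comp (hφ.comp (endEquiv d (n + m)).surjective)
  have hker (X) : P X = 0 ↔ phi (Wix d) (n + m) (endEquiv d (n + m) X) ∈ Jideal d n G :=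
    Submodule.Quotient.mk_eq_zero K
  have hInv : invFunctionals 4 (HN d n (n + m) h G) = LinearMap.range P.dualMap := by
    rw [LinearMap.range_dualMap_eq_dualAnnihilator_ker]
    ext f
    rw [mem_invFunctionals_HN_iff, Submodule.mem_dualAnnihilator]
    simp only [LinearMap.mem_ker, hker, inv_tensorExt, inv_permMatrix]
    constructor
    · rintro ⟨hG, hσ⟩ X hX
      have := eq_zero_of_phi_mem_Jideal h (f ∘ₗ (endEquiv d (n + m)).symm.toLinearMap)
        (fun g hg v => ?_) (fun σ v => ?_) hX
      · simpa using this
      · obtain ⟨Y, rfl⟩ := (endEquiv d (n + m)).surjective v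
        rw [← endEquiv_conj]
        simpa using hG g hg Y
      · obtain ⟨Y, rfl⟩ := (endEquiv d (n + m)).surjective v
        rw [← endEquiv_conj]
        simpa using hσ σ Y
    · intro hf
      refine ⟨fun g hg X => ?_, fun σ X => ?_⟩ <;> rw [← sub_eq_zero, ← map_sub] <;>
        refine hf _ ?_ <;> rw [map_sub, endEquiv_conj]
      · exact phi_wAction_tensorExt_sub_mem h hg _
      · rw [map_sub, phi_wAction_permMatrix, sub_self]
        exact Ideal.zero_mem _
  rw [Mdim, hInv, LinearMap.finrank_range_of_inj (LinearMap.dualMap_injective_of_surjective hP),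
    Subspace.dual_finrank_eq]
  rfl
end

section
/- Let m ≥ 2. Every closed normal subgroup of the special unitary group SU(m) that contains a non-scalar matrix equals SU(m). -/
open Matrix

namespace Matrix

variable {n : Type*} [Fintype n] [DecidableEq n]

/-- The homomorphism sending a tuple of unit complex numbers to the corresponding diagonal
unitary matrix. -/
def diagonalUnitary : (n → Circle) →* unitaryGroup n ℂ where
  toFun z := ⟨diagonal fun i => (z i : ℂ), by
    rw [mem_unitaryGroup_iff, star_eq_conjTranspose, diagonal_conjTranspose, diagonal_mul_diagonal,
      ← diagonal_one]
    congr 1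
    ext i
    simp [Complex.mul_conj]⟩
  map_one' := by ext; simp
  map_mul' x y := Subtype.ext (by simp [diagonal_mul_diagonal])

@[simp]
theorem coe_diagonalUnitary (z : n → Circle) :
    (diagonalUnitary z : Matrix n n ℂ) = diagonal fun i => (z i : ℂ) := rfl

/-- Cayley transform argument: a unitary matrix without eigenvalue `-1` is unitarily
diagonalizable. -/
theorem exists_eq_conj_diagonal_of_det_one_add_ne_zero (w : unitaryGroup n ℂ)
    (hw : (1 + (w : Matrix n n ℂ)).det ≠ 0) :
    ∃ (V : unitaryGroup n ℂ) (d : n → ℂ),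
      ((V⁻¹ * w * V : unitaryGroup n ℂ) : Matrix n n ℂ) = diagonal d := by
  have hS : IsUnit (1 + (w : Matrix n n ℂ)).det := isUnit_iff_ne_zero.mpr hw
  set S : Matrix n n ℂ := 1 + (w : Matrix n n ℂ) with hSdef
  set A : Matrix n n ℂ := Complex.I • ((1 - (w : Matrix n n ℂ)) * S⁻¹) with hAdef
  have hAS : A * S = Complex.I • (1 - (w : Matrix n n ℂ)) := by
    rw [hAdef, smul_mul_assoc, mul_assoc, nonsing_inv_mul _ hS, mul_one]
  have hww : (w : Matrix n n ℂ)ᴴ * w = 1 := UnitaryGroup.star_mul_self w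
  have hA : A.IsHermitian := by
    have hSH : IsUnit (Sᴴ).det := by rw [det_conjTranspose]; exact hS.star
    have key : Sᴴ * (Aᴴ * S) = Sᴴ * (A * S) := by
      have h1 : Sᴴ * Aᴴ = -Complex.I • (1 - (w : Matrix n n ℂ)ᴴ) := by
        rw [← conjTranspose_mul, hAS]; simp
      rw [← mul_assoc, h1, hAS, hSdef]
      simp only [conjTranspose_add, conjTranspose_one, smul_mul_assoc, mul_smul_comm, neg_smul,
        ← smul_neg]
      congr 1
      noncomm_ring
      rw [hww]
      abel
    have h2 : Aᴴ * S = A * S := by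
      simpa [← mul_assoc, nonsing_inv_mul _ hSH] using congrArg ((Sᴴ)⁻¹ * ·) key
    change Aᴴ = A
    simpa [mul_assoc, mul_nonsing_inv _ hS] using congrArg (· * S⁻¹) h2
  set V := hA.eigenvectorUnitary
  have hsp : (star (V : Matrix n n ℂ)) * A * V = diagonal (fun i => (hA.eigenvalues i : ℂ)) := by
    have := hA.conjStarAlgAut_star_eigenvectorUnitary
    rw [Unitary.conjStarAlgAut_star_apply] at this
    exact this
  have hVV : (V : Matrix n n ℂ) * star (V : Matrix n n ℂ) = 1 := mem_unitaryGroup_iff.mp V.2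
  have hVV' : star (V : Matrix n n ℂ) * (V : Matrix n n ℂ) = 1 := UnitaryGroup.star_mul_self V
  set W : Matrix n n ℂ := star (V : Matrix n n ℂ) * w * V with hW
  have hDW : diagonal (fun i => (hA.eigenvalues i : ℂ)) * (1 + W) = Complex.I • (1 - W) := by
    have e1 : 1 + W = star (V : Matrix n n ℂ) * S * V := by
      rw [hSdef, mul_add, add_mul, mul_one, hVV']
    have e2 : 1 - W = star (V : Matrix n n ℂ) * (1 - w) * V := by
      rw [mul_sub, sub_mul, mul_one, hVV']
    rw [e1, e2, ← hsp]
    calc _ = star (V : Matrix n n ℂ) * A * (V * star (V : Matrix n n ℂ)) * S * V := by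
            simp only [mul_assoc]
      _ = star (V : Matrix n n ℂ) * (A * S) * V := by
            rw [hVV]; simp only [mul_assoc, mul_one]
      _ = _ := by rw [hAS]; simp
  refine ⟨V, fun i => W i i, ?_⟩
  change W = _
  ext i j
  rcases eq_or_ne i j with rfl | hij
  · simp
  · have := congrFun (congrFun hDW i) j
    rw [diagonal_mul] at this
    simp only [add_apply, sub_apply, smul_apply, one_apply_ne hij, smul_eq_mul] at this
    rw [diagonal_apply_ne _ hij]
    have h0 : ((hA.eigenvalues i : ℂ) + Complex.I) * W i j = 0 := by linear_combination this
    refine (mul_eq_zero.mp h0).resolve_left fun h => ?_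
    simpa using congrArg Complex.im h

theorem exists_circle_det_one_add_smul_ne_zero (u : Matrix n n ℂ) :
    ∃ c : Circle, (1 + (c : ℂ) • u).det ≠ 0 := by
  have hinf : Infinite Circle := by
    have : (Set.Ioc (-Real.pi) Real.pi).Infinite := Set.Ioc_infinite (by linarith [Real.pi_pos])
    have := this.to_subtype
    exact Infinite.of_injective _ Circle.argEquiv.symm.injective
  have hfin : {x : ℂ | u.charpoly.IsRoot x}.Finite := by
    simpa using! u.charpoly.finite_setOfPred_isRoot u.charpoly_monic.ne_zero
  obtain ⟨c, hc⟩ := (hfin.preimage (f := fun c : Circle => -(c : ℂ))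
    (fun a _ b _ h => Circle.ext (neg_injective h))).exists_notMem
  refine ⟨c⁻¹, fun h => hc ?_⟩
  change u.charpoly.eval (-(c : ℂ)) = 0
  rw [eval_charpoly]
  have : scalar n (-(c : ℂ)) - u = (-(c : ℂ)) • (1 + ((c⁻¹ : Circle) : ℂ) • u) := by
    rw [smul_add, smul_smul]
    ext i j
    by_cases hij : i = j <;> simp [scalar_apply, hij, sub_eq_add_neg]
  rw [this, det_smul, h, mul_zero]

/-- Spectral theorem for unitary matrices. -/
theorem exists_eq_conj_diagonalUnitary (u : unitaryGroup n ℂ) :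
    ∃ (V : unitaryGroup n ℂ) (z : n → Circle), u = V * diagonalUnitary z * V⁻¹ := by
  obtain ⟨c, hc⟩ := exists_circle_det_one_add_smul_ne_zero (u : Matrix n n ℂ)
  have hcu : ((diagonalUnitary (fun _ => c) * u : unitaryGroup n ℂ) : Matrix n n ℂ)
      = (c : ℂ) • (u : Matrix n n ℂ) := by
    rw [UnitaryGroup.mul_val, coe_diagonalUnitary, smul_eq_diagonal_mul]
  obtain ⟨V, d, hd⟩ := exists_eq_conj_diagonal_of_det_one_add_ne_zero
    (diagonalUnitary (fun _ => c) * u) (by rwa [hcu])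
  have hd' : ((V⁻¹ * u * V : unitaryGroup n ℂ) : Matrix n n ℂ)
      = diagonal fun i => (c : ℂ)⁻¹ * d i := by
    have : (c : ℂ) • ((V⁻¹ * u * V : unitaryGroup n ℂ) : Matrix n n ℂ) = diagonal d := by
      rw [← hd]
      simp only [UnitaryGroup.mul_val, UnitaryGroup.inv_val, ← smul_eq_diagonal_mul,
        coe_diagonalUnitary, mul_smul_comm, smul_mul_assoc]
    rw [← inv_smul_smul₀ c.coe_ne_zero ((V⁻¹ * u * V : unitaryGroup n ℂ) : Matrix n n ℂ), this,
      ← diagonal_smul]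
    rfl
  have hnorm : ∀ i, ‖(c : ℂ)⁻¹ * d i‖ = 1 := fun i => by
    have h := mem_unitaryGroup_iff.mp (V⁻¹ * u * V).2
    rw [hd', star_eq_conjTranspose, diagonal_conjTranspose, diagonal_mul_diagonal] at h
    have h := congrFun (congrFun h i) i
    rw [diagonal_apply_eq, one_apply_eq, Pi.star_apply, RCLike.star_def, Complex.mul_conj] at h
    have h : Complex.normSq ((c : ℂ)⁻¹ * d i) = 1 := by exact_mod_cast h
    rw [Complex.normSq_eq_norm_sq] at h
    exact (pow_eq_one_iff_of_nonneg (norm_nonneg _) two_ne_zero).mp h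
  refine ⟨V, fun i => ⟨(c : ℂ)⁻¹ * d i, mem_sphere_zero_iff_norm.mpr (hnorm i)⟩, ?_⟩
  have : diagonalUnitary (fun i => (⟨(c : ℂ)⁻¹ * d i, mem_sphere_zero_iff_norm.mpr (hnorm i)⟩
      : Circle)) = V⁻¹ * u * V := Subtype.ext hd'.symm
  rw [this]
  group

/-- The homomorphism letting a unitary matrix act on the coordinates in the range of an
injection `f`. -/
def blockUnitary {k : Type*} [Fintype k] [DecidableEq k] (f : k ↪ n) :
    unitaryGroup k ℂ →* unitaryGroup n ℂ := by
  have hE : ((1 : Matrix n n ℂ).submatrix id f)ᴴ * (1 : Matrix n n ℂ).submatrix id f = 1 := by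
    rw [conjTranspose_submatrix, conjTranspose_one,
      ← submatrix_mul _ _ f id f Function.bijective_id, one_mul, submatrix_one _ f.injective]
  have hmul : ∀ B C : Matrix k k ℂ, (1 + (1 : Matrix n n ℂ).submatrix id f * (B - 1) *
      ((1 : Matrix n n ℂ).submatrix id f)ᴴ) * (1 + (1 : Matrix n n ℂ).submatrix id f * (C - 1) *
      ((1 : Matrix n n ℂ).submatrix id f)ᴴ) = 1 + (1 : Matrix n n ℂ).submatrix id f * (B * C - 1) *
      ((1 : Matrix n n ℂ).submatrix id f)ᴴ := by
    intro B C
    set E := (1 : Matrix n n ℂ).submatrix id f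
    have : E * (B - 1) * Eᴴ * (E * (C - 1) * Eᴴ) = E * ((B - 1) * (C - 1)) * Eᴴ := by
      calc _ = E * (B - 1) * (Eᴴ * E) * (C - 1) * Eᴴ := by simp only [Matrix.mul_assoc]
        _ = _ := by rw [hE]; simp only [Matrix.mul_assoc, Matrix.one_mul]
    rw [add_mul, mul_add, mul_add, this, one_mul, mul_one, one_mul, add_assoc, ← Matrix.add_mul,
      ← Matrix.mul_add, ← Matrix.add_mul, ← Matrix.mul_add]
    congr 4
    noncomm_ring
  exact
  { toFun B := ⟨1 + (1 : Matrix n n ℂ).submatrix id f * ((B : Matrix k k ℂ) - 1) *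
        ((1 : Matrix n n ℂ).submatrix id f)ᴴ, by
      have h : star (1 + (1 : Matrix n n ℂ).submatrix id f * ((B : Matrix k k ℂ) - 1) *
          ((1 : Matrix n n ℂ).submatrix id f)ᴴ) = 1 + (1 : Matrix n n ℂ).submatrix id f *
          (star (B : Matrix k k ℂ) - 1) * ((1 : Matrix n n ℂ).submatrix id f)ᴴ := by
        simp [star_eq_conjTranspose, Matrix.mul_assoc]
      rw [mem_unitaryGroup_iff, h, hmul, mem_unitaryGroup_iff.mp B.2]
      simp⟩
    map_one' := Subtype.ext (by simp)
    map_mul' B C := Subtype.ext (hmul B C).symm }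

variable {k : Type*} [Fintype k] [DecidableEq k] (f : k ↪ n)

theorem coe_blockUnitary (B : unitaryGroup k ℂ) :
    (blockUnitary f B : Matrix n n ℂ) = 1 + (1 : Matrix n n ℂ).submatrix id f *
      ((B : Matrix k k ℂ) - 1) * ((1 : Matrix n n ℂ).submatrix id f)ᴴ := rfl

theorem diagonalUnitary_conj_blockUnitary (z : n → Circle) (B : unitaryGroup k ℂ) :
    diagonalUnitary z * blockUnitary f B * (diagonalUnitary z)⁻¹ =
      blockUnitary f (diagonalUnitary (z ∘ f) * B * (diagonalUnitary (z ∘ f))⁻¹) := by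
  have hzE : (diagonalUnitary z : Matrix n n ℂ) * (1 : Matrix n n ℂ).submatrix id f =
      (1 : Matrix n n ℂ).submatrix id f * (diagonalUnitary (z ∘ f) : Matrix k k ℂ) := by
    ext i j
    rw [coe_diagonalUnitary, coe_diagonalUnitary, diagonal_mul, mul_diagonal, submatrix_apply,
      one_apply]
    split_ifs with h <;> simp_all
  rw [mul_inv_eq_iff_eq_mul]
  have hEz : ((1 : Matrix n n ℂ).submatrix id f)ᴴ * (diagonalUnitary z : Matrix n n ℂ) =
      (diagonalUnitary (z ∘ f) : Matrix k k ℂ) * ((1 : Matrix n n ℂ).submatrix id f)ᴴ := by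
    ext i j
    rw [coe_diagonalUnitary, coe_diagonalUnitary, diagonal_mul, mul_diagonal,
      conjTranspose_apply, submatrix_apply, one_apply]
    split_ifs with h <;> simp_all
  have hd : star (diagonalUnitary (z ∘ f) : Matrix k k ℂ) * (diagonalUnitary (z ∘ f) : Matrix k k ℂ)
      = 1 := UnitaryGroup.star_mul_self _
  refine Subtype.ext ?_
  simp only [UnitaryGroup.mul_val, coe_blockUnitary, UnitaryGroup.inv_val]
  rw [mul_add, add_mul, Matrix.mul_assoc _ _ (diagonalUnitary z : Matrix n n ℂ), hEz, mul_one,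
    one_mul, ← Matrix.mul_assoc, ← Matrix.mul_assoc, hzE]
  congr 1
  rw [← Matrix.mul_assoc]
  congr 1
  simp only [Matrix.mul_assoc]
  congr 1
  simp only [Matrix.mul_sub, Matrix.sub_mul, Matrix.mul_one, Matrix.one_mul, Matrix.mul_assoc, hd]

theorem blockUnitary_diagonalUnitary (f : Fin 2 ↪ n) (w : Fin 2 → Circle) :
    blockUnitary f (diagonalUnitary w) =
      diagonalUnitary (Pi.mulSingle (f 0) (w 0) * Pi.mulSingle (f 1) (w 1)) := by
  have hij : f 0 ≠ f 1 := f.injective.ne (by decide)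
  refine Subtype.ext ?_
  rw [coe_blockUnitary]
  ext p q
  simp only [coe_diagonalUnitary, Matrix.add_apply, Matrix.mul_apply, Fin.sum_univ_two,
    submatrix_apply, conjTranspose_apply, Matrix.sub_apply, id_eq, Matrix.one_apply]
  rcases eq_or_ne p q with rfl | hpq
  · by_cases hi : p = f 0
    · simp [hi, hij]
    · by_cases hj : p = f 1
      · simp [hj, hij.symm]
      · simp [hi, hj]
  · by_cases hi : p = f 0
    · have hq : q ≠ f 0 := fun h => hpq (hi.trans h.symm)
      simp [hi, hij, hq, hq.symm]
    · by_cases hj : p = f 1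
      · have hq : q ≠ f 1 := fun h => hpq (hj.trans h.symm)
        simp [hj, hij.symm, hq, hq.symm]
      · simp [hi, hj, hpq]

theorem det_diagonalUnitary (z : n → Circle) :
    (diagonalUnitary z : Matrix n n ℂ).det = ((∏ i, z i : Circle) : ℂ) := by
  rw [coe_diagonalUnitary, det_diagonal]
  exact (map_prod Circle.coeHom z Finset.univ).symm

theorem diagonalUnitary_comp_perm (z : n → Circle) (σ : Equiv.Perm n) :
    ∃ P : unitaryGroup n ℂ, diagonalUnitary (z ∘ σ) = P * diagonalUnitary z * P⁻¹ := by
  have hP : (1 : Matrix n n ℂ).submatrix σ id ∈ unitaryGroup n ℂ := by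
    rw [mem_unitaryGroup_iff, star_eq_conjTranspose, conjTranspose_submatrix, conjTranspose_one,
      ← submatrix_mul _ _ σ id σ Function.bijective_id, one_mul, submatrix_one _ σ.injective]
  refine ⟨⟨_, hP⟩, ?_⟩
  rw [eq_mul_inv_iff_mul_eq]
  refine Subtype.ext ?_
  simp only [UnitaryGroup.mul_val, coe_diagonalUnitary]
  ext i j
  rw [diagonal_mul, mul_diagonal, submatrix_apply, one_apply]
  split_ifs with h <;> simp_all

/-- The real rotation of the plane with cosine `c` and sine `s`, as a unitary matrix. -/
def planeRotation (c s : ℝ) (h : c ^ 2 + s ^ 2 = 1) : unitaryGroup (Fin 2) ℂ :=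
  ⟨!![(c : ℂ), -s; s, c], by
    have h' : (c : ℂ) ^ 2 + (s : ℂ) ^ 2 = 1 := by exact_mod_cast h
    rw [mem_unitaryGroup_iff]
    ext i j
    fin_cases i <;> fin_cases j <;>
      simp [Matrix.mul_apply, star_apply] <;> first | ring1 | linear_combination h'⟩

theorem trace_commutator_planeRotation (y : Fin 2 → Circle) (c s : ℝ) (h : c ^ 2 + s ^ 2 = 1) :
    (diagonalUnitary y * planeRotation c s h * (diagonalUnitary y)⁻¹ * (planeRotation c s h)⁻¹ :
      unitaryGroup (Fin 2) ℂ).1.trace =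
      ((2 * (c ^ 2 + s ^ 2 * ((y 0 / y 1 : Circle) : ℂ).re) : ℝ) : ℂ) := by
  have hy : ∀ i, (starRingEnd ℂ) (y i : ℂ) * y i = 1 := fun i => by
    simp [← Complex.normSq_eq_conj_mul_self]
  have hre : (2 : ℂ) * (((y 0 / y 1 : Circle) : ℂ).re : ℂ) =
      y 0 * (starRingEnd ℂ) (y 1 : ℂ) + (starRingEnd ℂ) (y 0 : ℂ) * y 1 := by
    have := Complex.add_conj ((y 0 / y 1 : Circle) : ℂ)
    rw [div_eq_mul_inv, Circle.coe_mul, Circle.coe_inv_eq_conj, map_mul, Complex.conj_conj] at this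
    rw [div_eq_mul_inv, Circle.coe_mul, Circle.coe_inv_eq_conj, this]
    push_cast
    ring
  simp [trace_fin_two, Matrix.mul_apply, planeRotation, star_apply, diagonal_apply,
    -Circle.coe_div]
  linear_combination (-(s : ℂ) ^ 2) * hre + (c : ℂ) ^ 2 * (hy 0 + hy 1)

theorem circle_re_lt_one {w : Circle} (hw : w ≠ 1) : (w : ℂ).re < 1 := by
  have hle : (w : ℂ).re ≤ 1 := (Complex.re_le_norm _).trans_eq w.norm_coe
  refine lt_of_le_of_ne hle fun h => hw ?_
  have h1 : (w : ℂ).re ^ 2 + (w : ℂ).im ^ 2 = 1 := by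
    have := Circle.normSq_coe w
    rw [Complex.normSq_apply] at this
    linarith
  have h2 : (w : ℂ).im = 0 := by
    rw [h] at h1
    exact pow_eq_zero_iff two_ne_zero |>.mp (by linarith)
  exact Circle.ext (Complex.ext (by simpa using h) (by simpa using h2))

theorem circle_eq_or_eq_inv_of_re_eq {w z : Circle} (h : (w : ℂ).re = (z : ℂ).re) :
    w = z ∨ w = z⁻¹ := by
  have hw := Circle.normSq_coe w
  have hz := Circle.normSq_coe z
  rw [Complex.normSq_apply] at hw hz
  have : (w : ℂ).im ^ 2 = (z : ℂ).im ^ 2 := by rw [h] at hw; linarith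
  rcases sq_eq_sq_iff_eq_or_eq_neg.mp this with him | him
  · exact Or.inl (Circle.ext (Complex.ext h him))
  · refine Or.inr (Circle.ext ?_)
    rw [Circle.coe_inv_eq_conj]
    exact Complex.ext (by simpa using h) (by simpa using him)

/-- Every unit complex number is a power of unit complex numbers arbitrarily close to `1`. -/
theorem circle_exists_pow_eq (ζ : Circle) {r : ℝ} (hr : r < 1) :
    ∃ (w : Circle) (N : ℕ), w ^ N = ζ ∧ r ≤ (w : ℂ).re := by
  obtain ⟨θ, rfl⟩ := Circle.exp_surjective ζ
  have hlim : Filter.Tendsto (fun N : ℕ => Real.cos (θ / N)) Filter.atTop (nhds 1) := by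
    have := (Real.continuous_cos.tendsto 0).comp (tendsto_const_div_atTop_nhds_zero_nat θ)
    simpa using! this
  obtain ⟨N, hN, hN0⟩ := ((hlim.eventually (lt_mem_nhds hr)).and
    (Filter.eventually_gt_atTop 0)).exists
  refine ⟨Circle.exp (θ / N), N, ?_, ?_⟩
  · rw [← Circle.exp_nsmul, nsmul_eq_mul, mul_div_cancel₀ _ (by positivity)]
  · rw [Circle.coe_exp, Complex.exp_ofReal_mul_I_re]
    exact hN.le

theorem diagonalUnitary_mem_of_commutator_mem (K : Subgroup (unitaryGroup (Fin 2) ℂ)) [K.Normal]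
    {y : Fin 2 → Circle} (hy : y 0 ≠ y 1)
    (hK : ∀ g, diagonalUnitary y * g * (diagonalUnitary y)⁻¹ * g⁻¹ ∈ K) (ζ : Circle) :
    diagonalUnitary ![ζ, ζ⁻¹] ∈ K := by
  set r : ℝ := ((y 0 / y 1 : Circle) : ℂ).re with hr_def
  have hr : r < 1 := circle_re_lt_one (by rwa [ne_eq, div_eq_one])
  obtain ⟨w, N, rfl, hw⟩ := circle_exists_pow_eq ζ hr
  suffices h : diagonalUnitary ![w, w⁻¹] ∈ K by
    have : (![w ^ N, (w ^ N)⁻¹] : Fin 2 → Circle) = ![w, w⁻¹] ^ N := by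
      ext i; fin_cases i <;> simp
    rw [this, map_pow]
    exact K.pow_mem h N
  have hw1 : (w : ℂ).re ≤ 1 := (Complex.re_le_norm _).trans_eq w.norm_coe
  set t : ℝ := (1 - (w : ℂ).re) / (1 - r) with ht_def
  have hr' : 0 < 1 - r := by linarith
  have ht0 : 0 ≤ t := div_nonneg (by linarith) hr'.le
  have ht1 : t ≤ 1 := (div_le_one hr').mpr (by linarith)
  have ht : t * (1 - r) = 1 - (w : ℂ).re := div_mul_cancel₀ _ hr'.ne'
  have hs := Real.sq_sqrt ht0
  have hc := Real.sq_sqrt (sub_nonneg.mpr ht1)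
  have hcs : √(1 - t) ^ 2 + √t ^ 2 = 1 := by rw [hs, hc]; ring
  have hB := hK (planeRotation _ _ hcs)
  have htr := trace_commutator_planeRotation y _ _ hcs
  have hdet : (diagonalUnitary y * planeRotation _ _ hcs * (diagonalUnitary y)⁻¹ *
      (planeRotation _ _ hcs)⁻¹ : unitaryGroup (Fin 2) ℂ).1.det = 1 := by
    have hinv : ∀ g : unitaryGroup (Fin 2) ℂ,
        (g : Matrix (Fin 2) (Fin 2) ℂ).det * (star (g : Matrix (Fin 2) (Fin 2) ℂ)).det = 1 :=
      fun g => by rw [← det_mul, mem_unitaryGroup_iff.mp g.2, det_one]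
    simp only [UnitaryGroup.mul_val, UnitaryGroup.inv_val, det_mul]
    linear_combination (planeRotation _ _ hcs).1.det * (star (planeRotation _ _ hcs).1).det *
      hinv (diagonalUnitary y) + hinv (planeRotation _ _ hcs)
  obtain ⟨V, z, hVz⟩ := exists_eq_conj_diagonalUnitary (diagonalUnitary y * planeRotation _ _ hcs *
    (diagonalUnitary y)⁻¹ * (planeRotation _ _ hcs)⁻¹)
  rw [hVz] at hB htr hdet
  have hVV : star (V : Matrix (Fin 2) (Fin 2) ℂ) * V = 1 := UnitaryGroup.star_mul_self V
  have hzK : diagonalUnitary z ∈ K := by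
    simpa [mul_assoc] using (inferInstance : K.Normal).conj_mem _ hB V⁻¹
  rw [UnitaryGroup.mul_val, UnitaryGroup.mul_val, UnitaryGroup.inv_val] at htr hdet
  rw [trace_mul_comm, ← mul_assoc, hVV, one_mul, coe_diagonalUnitary, trace_diagonal,
    Fin.sum_univ_two] at htr
  rw [det_mul_comm, ← mul_assoc, hVV, one_mul, det_diagonalUnitary, Fin.prod_univ_two,
    Circle.coe_eq_one] at hdet
  have hz1 : z 1 = (z 0)⁻¹ := eq_inv_of_mul_eq_one_right hdet
  have hz : z = ![z 0, (z 0)⁻¹] := by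
    ext i; fin_cases i <;> simp [hz1]
  have hre : (z 0 : ℂ).re = (w : ℂ).re := by
    have := congrArg Complex.re htr
    rw [hz1, Complex.add_re, Circle.coe_inv_eq_conj, Complex.conj_re, Complex.ofReal_re, hs, hc]
      at this
    linarith
  rcases circle_eq_or_eq_inv_of_re_eq hre with h | h
  · rwa [hz, h] at hzK
  · rw [hz, h] at hzK
    have : (![w, w⁻¹] : Fin 2 → Circle) = ![w⁻¹, w⁻¹⁻¹]⁻¹ := by
      ext i; fin_cases i <;> simp
    rw [this, map_inv]
    exact K.inv_mem hzK

/-- A subgroup of `ι → G` containing, for a fixed `i` and all `j ≠ i`, the tuples with entries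
`ζ` at `i` and `ζ⁻¹` at `j`, contains every tuple of product one. -/
theorem mem_of_prod_eq_one {ι G : Type*} [Fintype ι] [DecidableEq ι] [CommGroup G]
    (K : Subgroup (ι → G)) (i : ι)
    (hK : ∀ j ≠ i, ∀ ζ, Pi.mulSingle i ζ * Pi.mulSingle j ζ⁻¹ ∈ K) {z : ι → G}
    (hz : ∏ j, z j = 1) : z ∈ K := by
  have h1 : z = ∏ j, (Pi.mulSingle j (z j) * Pi.mulSingle i (z j)⁻¹) := by
    have h2 := map_prod (MonoidHom.mulSingle (fun _ : ι => G) i) (fun j => (z j)⁻¹) Finset.univ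
    rw [Finset.prod_inv_distrib, hz, inv_one, map_one] at h2
    rw [Finset.prod_mul_distrib, Finset.univ_prod_mulSingle]
    exact (mul_one z).symm.trans (congrArg (z * ·) h2)
  rw [h1]
  refine K.prod_mem fun j _ => ?_
  rcases eq_or_ne j i with rfl | hji
  · rw [← Pi.mulSingle_mul, mul_inv_cancel, Pi.mulSingle_one]
    exact K.one_mem
  · simpa [mul_comm] using hK j hji (z j)⁻¹

/-- A normal subgroup of the unitary group containing a non-scalar matrix contains every unitary
matrix of determinant one. -/
theorem mem_normal_of_det_eq_one (H : Subgroup (unitaryGroup n ℂ)) [hH : H.Normal]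
    {h : unitaryGroup n ℂ} (hh : h ∈ H)
    (hns : ∀ α : ℂ, (h : Matrix n n ℂ) ≠ α • (1 : Matrix n n ℂ))
    {u : unitaryGroup n ℂ} (hu : (u : Matrix n n ℂ).det = 1) : u ∈ H := by
  obtain ⟨V, y, rfl⟩ := exists_eq_conj_diagonalUnitary h
  have hyH : diagonalUnitary y ∈ H := by simpa [mul_assoc] using hH.conj_mem _ hh V⁻¹
  obtain ⟨i, j, hij⟩ : ∃ i j, y i ≠ y j := by
    by_contra! hall
    rcases isEmpty_or_nonempty n with hn | ⟨⟨i⟩⟩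
    · exact hns 0 (Subsingleton.elim _ _)
    · refine hns (y i : ℂ) ?_
      have : (diagonalUnitary y : Matrix n n ℂ) = (y i : ℂ) • (1 : Matrix n n ℂ) := by
        rw [coe_diagonalUnitary, smul_one_eq_diagonal]
        congr 1
        ext j
        rw [hall j i]
      rw [UnitaryGroup.mul_val, UnitaryGroup.mul_val, UnitaryGroup.inv_val, this, mul_smul_comm,
        mul_one, smul_mul_assoc, mem_unitaryGroup_iff.mp V.2]
  have hne : i ≠ j := fun h => hij (congrArg y h)
  let f : Fin 2 ↪ n := ⟨![i, j], by
    intro a b hab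
    fin_cases a <;> fin_cases b <;> simp_all [hne.symm]⟩
  have hfij : ∀ ζ : Circle,
      diagonalUnitary (Pi.mulSingle i ζ * Pi.mulSingle j ζ⁻¹ : n → Circle) ∈ H := by
    intro ζ
    have hmem := diagonalUnitary_mem_of_commutator_mem (H.comap (blockUnitary f)) (y := y ∘ f) hij
      (fun g => by
        rw [Subgroup.mem_comap, map_mul, ← diagonalUnitary_conj_blockUnitary, map_inv, mul_assoc,
          mul_assoc, ← mul_assoc (blockUnitary f g)]
        exact H.mul_mem hyH (hH.conj_mem _ (H.inv_mem hyH) _)) ζ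
    rw [Subgroup.mem_comap, blockUnitary_diagonalUnitary] at hmem
    exact hmem
  obtain ⟨U, z, rfl⟩ := exists_eq_conj_diagonalUnitary u
  refine hH.conj_mem _ ?_ U
  have hz : ∏ k, z k = 1 := by
    rw [UnitaryGroup.mul_val, UnitaryGroup.mul_val, UnitaryGroup.inv_val, det_mul_comm,
      ← mul_assoc, UnitaryGroup.star_mul_self U, one_mul, det_diagonalUnitary,
      Circle.coe_eq_one] at hu
    exact hu
  refine mem_of_prod_eq_one (H.comap diagonalUnitary) i (fun k hk ζ => ?_) hz
  obtain ⟨P, hP⟩ := diagonalUnitary_comp_perm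
    (Pi.mulSingle i ζ * Pi.mulSingle j ζ⁻¹ : n → Circle) (Equiv.swap j k)
  have hcomp : (Pi.mulSingle i ζ * Pi.mulSingle j ζ⁻¹ : n → Circle) ∘ Equiv.swap j k =
      Pi.mulSingle i ζ * Pi.mulSingle k ζ⁻¹ := by
    ext l
    by_cases hlj : l = j
    · subst hlj
      by_cases hlk : l = k
      · subst hlk; simp
      · simp [hne.symm, hlk, hk, Ne.symm hlk]
    · by_cases hlk : l = k
      · subst hlk; simp [hk, hne.symm]
      · simp [Equiv.swap_apply_of_ne_of_ne hlj hlk, hlj, hlk, Pi.mulSingle_apply]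
  rw [Subgroup.mem_comap, ← hcomp, hP]
  exact hH.conj_mem _ (hfij ζ) P

/-- Every unitary matrix becomes special unitary after multiplication by a scalar. -/
theorem exists_scalar_mul_det_eq_one [Nonempty n] (g : unitaryGroup n ℂ) :
    ∃ c : Circle,
      ((diagonalUnitary (fun _ => c) * g : unitaryGroup n ℂ) : Matrix n n ℂ).det = 1 := by
  obtain ⟨U, z, rfl⟩ := exists_eq_conj_diagonalUnitary g
  obtain ⟨θ, hθ⟩ := Circle.exp_surjective (∏ k, z k)⁻¹
  refine ⟨Circle.exp (θ / Fintype.card n), ?_⟩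
  have hU : (U : Matrix n n ℂ).det * (star (U : Matrix n n ℂ)).det = 1 := by
    rw [← det_mul, mem_unitaryGroup_iff.mp U.2, det_one]
  have hc : ∏ _k : n, Circle.exp (θ / Fintype.card n) = (∏ k, z k)⁻¹ := by
    rw [Finset.prod_const, Finset.card_univ, ← Circle.exp_nsmul, nsmul_eq_mul,
      mul_div_cancel₀ _ (Nat.cast_ne_zero.mpr Fintype.card_ne_zero), hθ]
  have hz : (((∏ k, z k)⁻¹ : Circle) : ℂ) * ((∏ k, z k : Circle) : ℂ) = 1 := by
    rw [← Circle.coe_mul, inv_mul_cancel, Circle.coe_one]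
  simp only [UnitaryGroup.mul_val, UnitaryGroup.inv_val, det_mul, det_diagonalUnitary, hc]
  linear_combination (((∏ k, z k)⁻¹ : Circle) : ℂ) * ((∏ k, z k : Circle) : ℂ) * hU + hz

theorem commute_diagonalUnitary_const (c : Circle) (g : unitaryGroup n ℂ) :
    Commute (diagonalUnitary fun _ => c) g :=
  Subtype.ext (by
    simp only [UnitaryGroup.mul_val, coe_diagonalUnitary]
    rw [← smul_eq_diagonal_mul, ← smul_one_eq_diagonal, mul_smul_comm, mul_one])

/-- A subgroup of the unitary group normalized by the special unitary group is normal. -/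
theorem normal_of_conj_mem_of_det_eq_one [Nonempty n] (H : Subgroup (unitaryGroup n ℂ))
    (hH : ∀ g : unitaryGroup n ℂ, (g : Matrix n n ℂ).det = 1 → ∀ h ∈ H, g * h * g⁻¹ ∈ H) :
    H.Normal := by
  refine ⟨fun x hx g => ?_⟩
  obtain ⟨c, hc⟩ := exists_scalar_mul_det_eq_one g
  have h := hH _ hc x hx
  have hcomm := commute_diagonalUnitary_const c (g * x * g⁻¹)
  have : diagonalUnitary (fun _ => c) * g * x * (diagonalUnitary (fun _ => c) * g)⁻¹
      = g * x * g⁻¹ := by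
    calc _ = diagonalUnitary (fun _ => c) * (g * x * g⁻¹) * (diagonalUnitary fun _ => c)⁻¹ := by
            group
      _ = g * x * g⁻¹ := by rw [hcomm.eq, mul_inv_cancel_right]
  rwa [this] at h

end Matrix

/-- For `m ≥ 2`, every closed normal subgroup of `SU(m)` containing a
non-scalar matrix equals `SU(m)`. Here `SU(m)` is realized as the set of elements of the
unitary group `U(m)` of determinant `1`, and `H` is a subgroup of `U(m)` contained in
`SU(m)`, closed, normalized by `SU(m)`, and containing a non-scalar matrix. -/
theorem closed_normal_subgroup_of_SU_eq_SU {m : ℕ} (hm : 2 ≤ m)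
    (H : Subgroup (Matrix.unitaryGroup (Fin m) ℂ))
    (hdet : ∀ u ∈ H, (u : Matrix (Fin m) (Fin m) ℂ).det = 1)
    (hclosed : IsClosed (H : Set (Matrix.unitaryGroup (Fin m) ℂ)))
    (hnormal : ∀ g : Matrix.unitaryGroup (Fin m) ℂ, (g : Matrix (Fin m) (Fin m) ℂ).det = 1 →
      ∀ h ∈ H, g * h * g⁻¹ ∈ H)
    (hns : ∃ h ∈ H, ∀ α : ℂ, (h : Matrix (Fin m) (Fin m) ℂ) ≠ α • (1 : Matrix (Fin m) (Fin m) ℂ)) :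
    (H : Set (Matrix.unitaryGroup (Fin m) ℂ))
      = {g : Matrix.unitaryGroup (Fin m) ℂ | (g : Matrix (Fin m) (Fin m) ℂ).det = 1} := by
  obtain ⟨h, hh, hns⟩ := hns
  have : Nonempty (Fin m) := ⟨⟨0, by omega⟩⟩
  have hH : H.Normal := normal_of_conj_mem_of_det_eq_one H hnormal
  refine Set.Subset.antisymm (fun u hu => hdet u hu) fun u hu => ?_
  exact mem_normal_of_det_eq_one H hh hns hu
end

section
/- Let m ≥ 2 and let G be a closed (hence compact) subgroup of SU(m). Suppose that the space of ℂ-linear maps Φ : M_m(ℂ) → M_m(ℂ) satisfying Φ(g X g^{-1}) = g Φ(X) g^{-1} for all g ∈ G and X ∈ M_m(ℂ) has complex dimension 2 (i.e., M_4(G) = 2). Then the real vector space su(m) of traceless skew-Hermitian m × m matrices is an irreducible real representation of G under the conjugation action X ↦ g X g^{-1}. -/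
open Matrix

/-- The space of `ℂ`-linear maps `Φ : M_m(ℂ) → M_m(ℂ)` commuting with the conjugation
action of every `g ∈ C`. -/
noncomputable def intertwiners (m : ℕ) (C : Set (Matrix (Fin m) (Fin m) ℂ)) :
    Submodule ℂ (Matrix (Fin m) (Fin m) ℂ →ₗ[ℂ] Matrix (Fin m) (Fin m) ℂ) where
  carrier := {Φ | ∀ g ∈ C, ∀ X, Φ (g * X * g⁻¹) = g * Φ X * g⁻¹}
  add_mem' := by
    intro a b ha hb g hg X
    simp [ha g hg X, hb g hg X, mul_add, add_mul]
  zero_mem' := by intro g hg X; simp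
  smul_mem' := by
    intro c a ha g hg X
    simp [ha g hg X, Matrix.mul_smul, Matrix.smul_mul]

/-- The complexification `S + iS` of a real subspace `S` of `M_m(ℂ)`. -/
def complexification {m : ℕ} (S : Submodule ℝ (Matrix (Fin m) (Fin m) ℂ)) :
    Submodule ℂ (Matrix (Fin m) (Fin m) ℂ) where
  carrier := {X | ∃ A ∈ S, ∃ B ∈ S, X = A + Complex.I • B}
  add_mem' := by
    rintro _ _ ⟨A, hA, B, hB, rfl⟩ ⟨A', hA', B', hB', rfl⟩
    exact ⟨A + A', S.add_mem hA hA', B + B', S.add_mem hB hB', by rw [smul_add]; abel⟩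
  zero_mem' := ⟨0, S.zero_mem, 0, S.zero_mem, by simp⟩
  smul_mem' := by
    rintro c _ ⟨A, hA, B, hB, rfl⟩
    refine ⟨c.re • A - c.im • B, S.sub_mem (S.smul_mem _ hA) (S.smul_mem _ hB),
      c.re • B + c.im • A, S.add_mem (S.smul_mem _ hB) (S.smul_mem _ hA), ?_⟩
    ext i j
    simp only [Matrix.smul_apply, Matrix.add_apply, Matrix.sub_apply, smul_eq_mul,
      Complex.real_smul]
    conv_lhs => rw [← Complex.re_add_im c]
    linear_combination (c.im * B i j : ℂ) * Complex.I_mul_I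

/-- The trace form `(X, Y) ↦ tr (X Y)` on `M_m(ℂ)`. -/
noncomputable def matrixTraceForm (m : ℕ) : LinearMap.BilinForm ℂ (Matrix (Fin m) (Fin m) ℂ) :=
  (LinearMap.mul ℂ (Matrix (Fin m) (Fin m) ℂ)).compr₂ (traceLinearMap (Fin m) ℂ ℂ)

@[simp]
lemma matrixTraceForm_apply {m : ℕ} (X Y : Matrix (Fin m) (Fin m) ℂ) :
    matrixTraceForm m X Y = (X * Y).trace := rfl

lemma matrixTraceForm_isRefl (m : ℕ) : (matrixTraceForm m).IsRefl := by
  intro X Y h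
  rw [matrixTraceForm_apply] at h ⊢
  rw [trace_mul_comm, h]

open scoped ComplexOrder in
/-- The complexification of a space of skew-Hermitian matrices is complementary to its orthogonal
for the trace form. -/
lemma isCompl_complexification {m : ℕ} {S : Submodule ℝ (Matrix (Fin m) (Fin m) ℂ)}
    (hS : ∀ A ∈ S, Aᴴ = -A) :
    IsCompl (complexification S) ((matrixTraceForm m).orthogonal (complexification S)) := by
  rw [LinearMap.BilinForm.isCompl_orthogonal_iff_disjoint (matrixTraceForm_isRefl m),
    Submodule.disjoint_def]
  rintro X ⟨A, hA, B, hB, rfl⟩ hX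
  have hmem : A - Complex.I • B ∈ complexification S :=
    ⟨A, hA, -B, S.neg_mem hB, by rw [smul_neg, sub_eq_add_neg]⟩
  have h := (LinearMap.BilinForm.mem_orthogonal_iff.mp hX) _ hmem
  have hstar : A - Complex.I • B = -(A + Complex.I • B)ᴴ := by
    rw [conjTranspose_add, conjTranspose_smul, hS A hA, hS B hB]
    simp [sub_eq_add_neg, add_comm]
  change ((A - Complex.I • B) * (A + Complex.I • B)).trace = 0 at h
  rw [hstar, neg_mul, trace_neg, neg_eq_zero] at h
  exact trace_conjTranspose_mul_self_eq_zero_iff.mp h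

/-- The projection onto a conjugation-invariant summand along a conjugation-invariant complement
commutes with conjugation. -/
lemma projection_mem_intertwiners {m : ℕ} {C : Set (Matrix (Fin m) (Fin m) ℂ)}
    {U W : Submodule ℂ (Matrix (Fin m) (Fin m) ℂ)} (hUW : IsCompl U W)
    (hU : ∀ g ∈ C, ∀ X ∈ U, g * X * g⁻¹ ∈ U) (hW : ∀ g ∈ C, ∀ X ∈ W, g * X * g⁻¹ ∈ W) :
    U.projection W hUW ∈ intertwiners m C := by
  intro g hg X
  have hsplit : g * X * g⁻¹ = g * U.projection W hUW X * g⁻¹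
      + g * (X - U.projection W hUW X) * g⁻¹ := by
    rw [← add_mul, ← mul_add, add_sub_cancel]
  rw [hsplit, map_add,
    Submodule.projection_apply_of_mem_left hUW
      (hU g hg _ (Submodule.projection_apply_mem hUW X)),
    (Submodule.projection_apply_eq_zero_iff hUW).mpr
      (hW g hg _ (Submodule.sub_projection_mem hUW X)), add_zero]

/-- The map `X ↦ tr(X) • 1`. -/
noncomputable def traceSMulOne (m : ℕ) :
    Matrix (Fin m) (Fin m) ℂ →ₗ[ℂ] Matrix (Fin m) (Fin m) ℂ :=
  (traceLinearMap (Fin m) ℂ ℂ).smulRight 1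

@[simp]
lemma traceSMulOne_apply {m : ℕ} (X : Matrix (Fin m) (Fin m) ℂ) :
    traceSMulOne m X = X.trace • (1 : Matrix (Fin m) (Fin m) ℂ) := rfl

lemma linearIndependent_id_traceSMulOne {m : ℕ} (hm : 2 ≤ m) :
    LinearIndependent ℂ ![LinearMap.id, traceSMulOne m] := by
  rw [LinearIndependent.pair_iff]
  intro c d h
  let i : Fin m := ⟨0, by omega⟩
  let j : Fin m := ⟨1, by omega⟩
  have hij : i ≠ j := by simp [i, j]
  have h₁ := congrFun (congrFun (LinearMap.congr_fun h (single i j 1)) i) j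
  have hc : c = 0 := by
    simpa [trace_single_eq_of_ne i j (1 : ℂ) hij, hij] using h₁
  have h₂ := congrFun (congrFun (LinearMap.congr_fun h (single i i 1)) i) i
  exact ⟨hc, by simpa [hc] using h₂⟩

/-- If the space of intertwiners is two-dimensional, every intertwiner is a combination of the
identity and `X ↦ tr(X) • 1`. -/
lemma exists_eq_smul_id_add_smul_traceSMulOne {m : ℕ} (hm : 2 ≤ m)
    {C : Set (Matrix (Fin m) (Fin m) ℂ)} (hC : ∀ g ∈ C, IsUnit g.det)
    (h : Module.finrank ℂ (intertwiners m C) = 2)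
    {Φ : Matrix (Fin m) (Fin m) ℂ →ₗ[ℂ] Matrix (Fin m) (Fin m) ℂ} (hΦ : Φ ∈ intertwiners m C) :
    ∃ a b : ℂ, Φ = a • LinearMap.id + b • traceSMulOne m := by
  have hle : Submodule.span ℂ (Set.range ![LinearMap.id, traceSMulOne m])
      ≤ intertwiners m C := by
    rw [Submodule.span_le, Set.range_subset_iff, Fin.forall_fin_two]
    refine ⟨fun g _ X => rfl, fun g hg X => ?_⟩
    have htr : (g * X * g⁻¹).trace = X.trace := by
      rw [trace_mul_cycle, nonsing_inv_mul _ (hC g hg), one_mul]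
    simp [htr, mul_nonsing_inv _ (hC g hg)]
  have heq := Submodule.eq_of_le_of_finrank_eq hle
    (by rw [finrank_span_eq_card (linearIndependent_id_traceSMulOne hm), h, Fintype.card_fin])
  rw [← heq, Matrix.range_cons, Matrix.range_cons, Matrix.range_empty, Set.union_empty,
    Set.singleton_union, Submodule.mem_span_pair] at hΦ
  obtain ⟨a, b, hab⟩ := hΦ
  exact ⟨a, b, hab.symm⟩

/-- A skew-Hermitian matrix in the complexification of a space `S` of skew-Hermitian matrices
lies in `S`. -/
lemma mem_of_mem_complexification {m : ℕ} {S : Submodule ℝ (Matrix (Fin m) (Fin m) ℂ)}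
    (hS : ∀ A ∈ S, Aᴴ = -A) {X : Matrix (Fin m) (Fin m) ℂ} (hX : Xᴴ = -X)
    (h : X ∈ complexification S) : X ∈ S := by
  obtain ⟨A, hA, B, hB, rfl⟩ := h
  rw [conjTranspose_add, conjTranspose_smul, hS A hA, hS B hB, neg_add, add_right_inj,
    Complex.star_def, Complex.conj_I, neg_smul_neg] at hX
  have hIB : Complex.I • B = 0 := by
    ext i j
    exact CharZero.eq_neg_self_iff.mp (congrFun (congrFun hX i) j)
  rwa [hIB, add_zero]

/-- Let `m ≥ 2` and let `G` be a closed subgroup of `SU(m)` (realized as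
a subgroup of the unitary group `U(m)` whose elements have determinant `1`). If the space
of `ℂ`-linear maps `Φ : M_m(ℂ) → M_m(ℂ)` with `Φ(g X g⁻¹) = g Φ(X) g⁻¹` for all `g ∈ G`
has dimension `2` (i.e. `M_4(G) = 2`), then the real vector space `su(m)` of traceless
skew-Hermitian matrices is an irreducible real representation of `G` under conjugation. -/
theorem su_irreducible_of_M4_eq_two {m : ℕ} (hm : 2 ≤ m)
    (G : Subgroup (Matrix.unitaryGroup (Fin m) ℂ))
    (hdet : ∀ g ∈ G, (g : Matrix (Fin m) (Fin m) ℂ).det = 1)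
    (hclosed : IsClosed (G : Set (Matrix.unitaryGroup (Fin m) ℂ)))
    (hM4 : Module.finrank ℂ (intertwiners m
        ((fun u : Matrix.unitaryGroup (Fin m) ℂ => (u : Matrix (Fin m) (Fin m) ℂ)) ''
          (G : Set (Matrix.unitaryGroup (Fin m) ℂ)))) = 2) :
    ∀ S : Submodule ℝ (Matrix (Fin m) (Fin m) ℂ),
      (∀ A ∈ S, Aᴴ = -A ∧ A.trace = 0) →
      (∀ g ∈ G, ∀ A ∈ S,
        (g : Matrix (Fin m) (Fin m) ℂ) * A * (g : Matrix (Fin m) (Fin m) ℂ)⁻¹ ∈ S) →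
      S = ⊥ ∨ (S : Set (Matrix (Fin m) (Fin m) ℂ))
          = {A : Matrix (Fin m) (Fin m) ℂ | Aᴴ = -A ∧ A.trace = 0} := by
  intro S hS hSG
  set C : Set (Matrix (Fin m) (Fin m) ℂ) :=
    (fun u : Matrix.unitaryGroup (Fin m) ℂ => (u : Matrix (Fin m) (Fin m) ℂ)) ''
      (G : Set (Matrix.unitaryGroup (Fin m) ℂ))
  have hC : ∀ g ∈ C, IsUnit g.det := by
    rintro _ ⟨g, hg, rfl⟩
    simp [hdet g hg]
  have hskew : ∀ A ∈ S, Aᴴ = -A := fun A hA => (hS A hA).1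
  have hU : ∀ g ∈ C, ∀ X ∈ complexification S, g * X * g⁻¹ ∈ complexification S := by
    rintro _ ⟨g, hg, rfl⟩ _ ⟨A, hA, B, hB, rfl⟩
    exact ⟨_, hSG g hg A hA, _, hSG g hg B hB, by simp [mul_add, add_mul]⟩
  have hinv : ∀ g ∈ C, g⁻¹ ∈ C := by
    rintro _ ⟨g, hg, rfl⟩
    refine ⟨g⁻¹, G.inv_mem hg, ?_⟩
    exact (inv_eq_left_inv (congrArg Subtype.val (inv_mul_cancel g))).symm
  have hW : ∀ g ∈ C, ∀ X ∈ (matrixTraceForm m).orthogonal (complexification S),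
      g * X * g⁻¹ ∈ (matrixTraceForm m).orthogonal (complexification S) := by
    intro g hg X hX
    rw [LinearMap.BilinForm.mem_orthogonal_iff] at hX ⊢
    intro Y hY
    have h := hX _ (hU _ (hinv g hg) Y hY)
    change ((g⁻¹ * Y * g⁻¹⁻¹) * X).trace = 0 at h
    change (Y * (g * X * g⁻¹)).trace = 0
    rw [nonsing_inv_nonsing_inv _ (hC g hg)] at h
    rw [← h, ← mul_assoc, trace_mul_comm]
    simp only [mul_assoc]
  have hcompl := isCompl_complexification hskew
  obtain ⟨a, b, hab⟩ := exists_eq_smul_id_add_smul_traceSMulOne hm hC hM4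
    (projection_mem_intertwiners hcompl hU hW)
  have htraceless : ∀ X : Matrix (Fin m) (Fin m) ℂ, X.trace = 0 →
      Submodule.projection _ _ hcompl X = a • X := by
    intro X hX
    simp [hab, hX]
  rw [or_iff_not_imp_left]
  intro hne
  obtain ⟨A, hA, hA0⟩ := Submodule.exists_mem_ne_zero_of_ne_bot hne
  have ha : a = 1 := by
    have h := htraceless A (hS A hA).2
    rw [Submodule.projection_apply_of_mem_left hcompl ⟨A, hA, 0, S.zero_mem, by simp⟩] at h
    exact smul_left_injective ℂ hA0 (by simpa using h.symm)
  refine Set.Subset.antisymm hS fun X hX => mem_of_mem_complexification hskew hX.1 ?_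
  rw [← Submodule.projection_eq_self_iff hcompl, htraceless X hX.2, ha, one_smul]
end
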